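/- For n ≥ 2, the number of well-labelled Motzkin paths of size n with exactly k horizontal steps equals C(n,k)·C(n-2,k)·k!·(n-k-1)!!·(n-k-3)!! if n-k is even, and 0 if n-k is odd. -/

import Mathlib

/-- The steps of the word are letters in `{-1,0,+1}`. -/
def StepsOK (n : ℕ) (p : Fin (n - 1) → ℤ) : Prop :=
  ∀ i, p i = -1 ∨ p i = 0 ∨ p i = 1

/-- Compatibility between the word and the permutation: a `-1` step forces an ascent
of the labels and a `+1` step forces a descent. -/
def Compat (n : ℕ) (p : Fin (n - 1) → ℤ) (σ : Equiv.Perm (Fin n)) : Prop :=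
  ∀ i : Fin (n - 1),
    (p i = -1 → σ ⟨i.1, by have := i.isLt; omega⟩ < σ ⟨i.1 + 1, by have := i.isLt; omega⟩) ∧
    (p i = 1 → σ ⟨i.1 + 1, by have := i.isLt; omega⟩ < σ ⟨i.1, by have := i.isLt; omega⟩)

/-- Partial sum `p 1 + ... + p j` of the word. -/
def psum (n : ℕ) (p : Fin (n - 1) → ℤ) (j : ℕ) : ℤ :=
  ∑ i ∈ Finset.univ.filter (fun i : Fin (n - 1) => i.1 < j), p i

/-- Well-labelled positive path of size `n`. -/
def IsPositivePath (n : ℕ) (p : Fin (n - 1) → ℤ) (σ : Equiv.Perm (Fin n)) : Prop :=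
  StepsOK n p ∧ Compat n p σ ∧ ∀ j ≤ n - 1, 0 ≤ psum n p j

/-- Well-labelled Motzkin path of size `n`. -/
def IsMotzkinPath (n : ℕ) (p : Fin (n - 1) → ℤ) (σ : Equiv.Perm (Fin n)) : Prop :=
  StepsOK n p ∧ Compat n p σ ∧ (∀ j ≤ n - 2, 0 ≤ psum n p j) ∧ psum n p (n - 1) = -1

/-- Number of well-labelled Motzkin paths of size `n`. -/
noncomputable def motzkinCount (n : ℕ) : ℕ :=
  Nat.card {ps : (Fin (n - 1) → ℤ) × Equiv.Perm (Fin n) // IsMotzkinPath n ps.1 ps.2}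

/-- Number of well-labelled positive paths of size `n`. -/
noncomputable def positiveCount (n : ℕ) : ℕ :=
  Nat.card {ps : (Fin (n - 1) → ℤ) × Equiv.Perm (Fin n) // IsPositivePath n ps.1 ps.2}

/-- Number of horizontal steps (letters `0`) of a word. -/
def horizCount (n : ℕ) (p : Fin (n - 1) → ℤ) : ℕ :=
  (Finset.univ.filter (fun i => p i = 0)).card

open Finset

section Vertices

variable {α : Type*}

/-- The number of horizontal steps of a list of vertices. -/
def flatCount : List (ℤ × α) → ℕ
  | u :: v :: l => (if u.1 = v.1 then 1 else 0) + flatCount (v :: l)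
  | _ => 0

@[simp] theorem flatCount_nil : flatCount ([] : List (ℤ × α)) = 0 := rfl

@[simp] theorem flatCount_singleton (u : ℤ × α) : flatCount [u] = 0 := rfl

@[simp] theorem flatCount_cons_cons (u v : ℤ × α) (l : List (ℤ × α)) :
    flatCount (u :: v :: l) = (if u.1 = v.1 then 1 else 0) + flatCount (v :: l) := rfl

theorem flatCount_append_cons (l₁ : List (ℤ × α)) (u : ℤ × α) (l₂ : List (ℤ × α)) :
    flatCount (l₁ ++ u :: l₂) = flatCount (l₁ ++ [u]) + flatCount (u :: l₂) := by
  induction l₁ with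
  | nil => simp
  | cons v l₁ ih =>
    cases l₁ with
    | nil => simp
    | cons w l₁ =>
      simp only [List.cons_append, flatCount_cons_cons] at ih ⊢
      rw [ih, add_assoc]

theorem flatCount_reverse (l : List (ℤ × α)) : flatCount l.reverse = flatCount l := by
  induction l with
  | nil => rfl
  | cons v l ih =>
    cases l with
    | nil => rfl
    | cons w l =>
      rw [List.reverse_cons] at ih
      rw [List.reverse_cons, List.reverse_cons, List.append_assoc, List.singleton_append,
        flatCount_append_cons, ih, flatCount_cons_cons, flatCount_cons_cons, flatCount_singleton,
        add_comm]
      simp [eq_comm]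

/-- The multiset of labels of a list of vertices. -/
def labels (l : List (ℤ × α)) : Multiset α := (l.map Prod.snd : List α)

theorem labels_append (l₁ l₂ : List (ℤ × α)) : labels (l₁ ++ l₂) = labels l₁ + labels l₂ := by
  simp [labels]

theorem labels_reverse (l : List (ℤ × α)) : labels l.reverse = labels l := by
  simp [labels]

theorem exists_append_cons_of_height {c : ℤ} {l : List (ℤ × α)} (h : ∃ w ∈ l, w.1 ≤ c) :
    ∃ l₁ u l₂, l = l₁ ++ u :: l₂ ∧ (∀ w ∈ l₁, c < w.1) ∧ u.1 ≤ c := by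
  induction l with
  | nil => simp at h
  | cons v l ih =>
    by_cases hv : v.1 ≤ c
    · exact ⟨[], v, l, rfl, by simp, hv⟩
    · obtain ⟨w, hw, hwc⟩ := h
      rcases List.mem_cons.1 hw with rfl | hw
      · exact (hv hwc).elim
      obtain ⟨l₁, u, l₂, rfl, h₁, hu⟩ := ih ⟨w, hw, hwc⟩
      refine ⟨v :: l₁, u, l₂, rfl, ?_, hu⟩
      intro w hw
      rcases List.mem_cons.1 hw with rfl | hw
      · omega
      · exact h₁ w hw

end Vertices

section Lists

variable {α β : Type*} [LinearOrder α] [LinearOrder β]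

/-- Consecutive vertices `(height, label)` of a well-labelled path. -/
def StepRel (u v : ℤ × α) : Prop :=
  (v.1 = u.1 - 1 ∧ u.2 < v.2) ∨ v.1 = u.1 ∨ (v.1 = u.1 + 1 ∧ v.2 < u.2)

theorem StepRel.symm {u v : ℤ × α} (h : StepRel u v) : StepRel v u := by
  unfold StepRel at *
  grind

theorem stepRel_comm {u v : ℤ × α} : StepRel u v ↔ StepRel v u :=
  ⟨StepRel.symm, StepRel.symm⟩

theorem isChain_stepRel_reverse {l : List (ℤ × α)} :
    l.reverse.IsChain StepRel ↔ l.IsChain StepRel := by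
  rw [List.isChain_reverse]
  simp only [stepRel_comm]

/-- A path from height `c` whose first vertex below height `c` is its last one. -/
def IsFirstPassage (c : ℤ) (l : List (ℤ × α)) : Prop :=
  l.IsChain StepRel ∧
    ∃ x m y, l = (c, x) :: (m ++ [(c - 1, y)]) ∧ ∀ v ∈ m, c ≤ v.1

theorem abs_height_sub_le {l : List (ℤ × α)} {u v : ℤ × α} (h : (u :: l).IsChain StepRel)
    (hv : v ∈ u :: l) : |v.1 - u.1| ≤ l.length := by
  induction l generalizing u with
  | nil => simp_all
  | cons w l ih =>
    rw [List.isChain_cons_cons] at h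
    rcases List.mem_cons.1 hv with rfl | hv
    · simp; positivity
    · have h1 := ih h.2 hv
      have h2 := h.1
      simp only [StepRel] at h2
      simp only [List.length_cons]
      push_cast
      rw [abs_le] at *
      omega

theorem finite_firstPassages (c : ℤ) (S : Finset α) (k : ℕ) :
    {l : List (ℤ × α) | IsFirstPassage c l ∧ labels l = S.val ∧ flatCount l = k}.Finite := by
  let A : Set (ℤ × α) := Set.Icc (c - #S) (c + #S) ×ˢ (S : Set α)
  have hA : A.Finite := (Set.finite_Icc _ _).prod S.finite_toSet
  have : Finite A := hA
  refine ((List.finite_length_eq A #S).image (List.map Subtype.val)).subset ?_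
  rintro l ⟨⟨hc, x, m, y, hl, -⟩, hS, -⟩
  have hlen : l.length = #S := by
    have := congrArg Multiset.card hS
    simpa [labels] using this
  have hmem : ∀ v ∈ l, v ∈ A := by
    intro v hv
    have h1 : |v.1 - c| ≤ (m ++ [(c - 1, y)]).length := by
      subst hl
      exact abs_height_sub_le hc hv
    have h2 : v.2 ∈ S := by
      rw [← Finset.mem_val, ← hS]
      simp only [labels, Multiset.mem_coe, List.mem_map]
      exact ⟨v, hv, rfl⟩
    have h3 : (m ++ [(c - 1, y)]).length + 1 = #S := by rw [← hlen, hl]; simp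
    refine ⟨?_, h2⟩
    rw [abs_le] at h1
    constructor <;> omega
  have : l ∈ Set.range (List.map (Subtype.val : A → ℤ × α)) := by
    rw [Set.range_list_map_coe]
    exact hmem
  obtain ⟨l', rfl⟩ := this
  exact ⟨l', by simpa using hlen, rfl⟩

/-- The first passage paths from height `c` with label set `S` and `k` horizontal steps. -/
noncomputable def firstPassages (c : ℤ) (S : Finset α) (k : ℕ) : Finset (List (ℤ × α)) :=
  (finite_firstPassages c S k).toFinset

@[simp] theorem mem_firstPassages {c : ℤ} {S : Finset α} {k : ℕ} {l : List (ℤ × α)} :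
    l ∈ firstPassages c S k ↔ IsFirstPassage c l ∧ labels l = S.val ∧ flatCount l = k := by
  simp [firstPassages]

/-- Raise the heights by `c` and transport the labels along `f`. -/
def transport (c : ℤ) (f : α ↪o β) (v : ℤ × α) : ℤ × β := (v.1 + c, f v.2)

theorem transport_injective (c : ℤ) (f : α ↪o β) : Function.Injective (transport c f) := by
  rintro ⟨h, a⟩ ⟨h', a'⟩ e
  simpa [transport] using e

theorem isFirstPassage_map_transport {c : ℤ} {f : α ↪o β} {l : List (ℤ × α)} :
    IsFirstPassage c (l.map (transport c f)) ↔ IsFirstPassage 0 l := by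
  unfold IsFirstPassage
  have hrel : ∀ u v : ℤ × α, StepRel (transport c f u) (transport c f v) ↔ StepRel u v := by
    intro u v
    simp only [StepRel, transport, OrderEmbedding.lt_iff_lt]
    grind
  rw [List.isChain_map]
  simp only [hrel]
  refine and_congr_right fun _ => ⟨?_, ?_⟩
  · rintro ⟨x, m, y, h, hm⟩
    rw [List.map_eq_cons_iff] at h
    obtain ⟨⟨h₁, x'⟩, l', rfl, hx, h⟩ := h
    rw [List.map_eq_append_iff] at h
    obtain ⟨m', l'', rfl, rfl, h⟩ := h
    rw [List.map_eq_singleton_iff] at h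
    obtain ⟨⟨h₂, y'⟩, rfl, hy⟩ := h
    simp only [transport, Prod.mk.injEq] at hx hy
    refine ⟨x', m', y', ?_, ?_⟩
    · rw [show h₁ = 0 by omega, show h₂ = 0 - 1 by omega]
    · intro v hv
      have := hm _ (List.mem_map_of_mem hv)
      simp only [transport] at this
      omega
  · rintro ⟨x, m, y, rfl, hm⟩
    refine ⟨f x, m.map (transport c f), f y, ?_, ?_⟩
    · simp [transport]
      ring
    · intro v hv
      obtain ⟨u, hu, rfl⟩ := List.mem_map.1 hv
      have := hm u hu
      simp only [transport]
      omega

theorem labels_map_transport (c : ℤ) (f : α ↪o β) (l : List (ℤ × α)) :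
    labels (l.map (transport c f)) = (labels l).map f := by
  simp [labels, transport, Function.comp_def]

theorem flatCount_map_transport (c : ℤ) (f : α ↪o β) (l : List (ℤ × α)) :
    flatCount (l.map (transport c f)) = flatCount l := by
  induction l with
  | nil => rfl
  | cons u l ih =>
    cases l with
    | nil => rfl
    | cons v l =>
      simp only [List.map_cons, flatCount_cons_cons] at ih ⊢
      rw [ih]
      simp [transport]

theorem firstPassages_map (c : ℤ) (f : α ↪o β) (S : Finset α) (k : ℕ) :
    firstPassages c (S.map f.toEmbedding) k =
      (firstPassages 0 S k).image (List.map (transport c f)) := by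
  ext l
  simp only [mem_image, mem_firstPassages]
  constructor
  · rintro ⟨hl, hS, hk⟩
    have : l ∈ Set.range (List.map (transport c f)) := by
      rw [Set.range_list_map]
      intro v hv
      have hv' : v.2 ∈ labels l := by
        simp only [labels, Multiset.mem_coe, List.mem_map]
        exact ⟨v, hv, rfl⟩
      rw [hS, Finset.mem_val, Finset.mem_map] at hv'
      obtain ⟨a, -, ha⟩ := hv'
      exact ⟨(v.1 - c, a), Prod.ext (by simp [transport]) ha⟩
    obtain ⟨l', rfl⟩ := this
    rw [isFirstPassage_map_transport] at hl
    rw [labels_map_transport, Finset.map_val] at hS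
    rw [flatCount_map_transport] at hk
    exact ⟨l', ⟨hl, Multiset.map_injective f.injective hS, hk⟩, rfl⟩
  · rintro ⟨l', ⟨hl, hS, hk⟩, rfl⟩
    rw [isFirstPassage_map_transport, labels_map_transport, flatCount_map_transport, hS]
    exact ⟨hl, rfl, hk⟩

/-- The number of first passage paths of size `n` with `k` horizontal steps. -/
noncomputable def firstPassageCount (n k : ℕ) : ℕ := #(firstPassages 0 (univ : Finset (Fin n)) k)

theorem card_firstPassages (c : ℤ) (S : Finset α) (k : ℕ) :
    #(firstPassages c S k) = firstPassageCount #S k := by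
  have h : S = (univ : Finset (Fin #S)).map (S.orderEmbOfFin rfl).toEmbedding := by
    simp
  conv_lhs => rw [h]
  rw [firstPassages_map, card_image_of_injective _
    (List.map_injective_iff.2 (transport_injective _ _)), firstPassageCount]

/-- Pairs of first passage paths whose label sets partition `S`. -/
noncomputable def passagePairs (c : ℤ) (S : Finset α) (k : ℕ) :
    Finset (List (ℤ × α) × List (ℤ × α)) :=
  (S.powerset ×ˢ antidiagonal k).biUnion fun t =>
    firstPassages c t.1 t.2.1 ×ˢ firstPassages 0 (S \ t.1) t.2.2

theorem mem_passagePairs {c : ℤ} {S : Finset α} {k : ℕ} {A B : List (ℤ × α)} :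
    (A, B) ∈ passagePairs c S k ↔ IsFirstPassage c A ∧ IsFirstPassage 0 B ∧
      labels A + labels B = S.val ∧ flatCount A + flatCount B = k := by
  simp only [passagePairs, mem_biUnion, mem_product, mem_powerset, mem_firstPassages,
    HasAntidiagonal.mem_antidiagonal, Prod.exists]
  constructor
  · rintro ⟨T, j, j', ⟨hT, hk⟩, ⟨hA, hAT, rfl⟩, hB, hBT, rfl⟩
    refine ⟨hA, hB, ?_, hk⟩
    rw [hAT, hBT, Finset.sdiff_val, add_tsub_cancel_of_le (Finset.val_le_iff.2 hT)]
  · rintro ⟨hA, hB, hS, hk⟩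
    have hle : labels A ≤ S.val := hS ▸ Multiset.le_add_right _ _
    refine ⟨⟨labels A, Multiset.nodup_of_le hle S.nodup⟩, flatCount A, flatCount B,
      ⟨Finset.val_le_iff.1 hle, hk⟩, ⟨hA, rfl, rfl⟩, hB, ?_, rfl⟩
    rw [Finset.sdiff_val]
    change labels B = S.val - labels A
    rw [← hS, add_tsub_cancel_left]

theorem card_passagePairs (c : ℤ) (S : Finset α) (k : ℕ) :
    #(passagePairs c S k) = ∑ x ∈ antidiagonal #S, (#S).choose x.1 *
      ∑ y ∈ antidiagonal k, firstPassageCount x.1 y.1 * firstPassageCount x.2 y.2 := by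
  rw [passagePairs, card_biUnion, sum_product, Nat.sum_antidiagonal_eq_sum_range_succ_mk]
  · have : ∀ T ∈ S.powerset, ∑ y ∈ antidiagonal k,
        #(firstPassages c T y.1 ×ˢ firstPassages 0 (S \ T) y.2) =
        (fun i => ∑ y ∈ antidiagonal k,
          firstPassageCount i y.1 * firstPassageCount (#S - i) y.2) #T := by
      intro T hT
      rw [mem_powerset] at hT
      simp only [card_product, card_firstPassages, card_sdiff_of_subset hT]
    rw [sum_congr rfl this, sum_powerset_apply_card (fun i => ∑ y ∈ antidiagonal k,
          firstPassageCount i y.1 * firstPassageCount (#S - i) y.2)]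
    rfl
  · rintro ⟨T, j, j'⟩ _ ⟨T', i, i'⟩ _ hne
    rw [Function.onFun, Finset.disjoint_left]
    rintro ⟨A, B⟩ h h'
    simp only [mem_product, mem_firstPassages] at h h'
    refine hne ?_
    obtain ⟨⟨-, h1, rfl⟩, -, -, rfl⟩ := h
    obtain ⟨⟨-, h2, rfl⟩, -, -, rfl⟩ := h'
    rw [Finset.val_injective (h1.symm.trans h2)]

/-- The first label of `A` is smaller than the first label of `B`. -/
def HeadLt (A B : List (ℤ × α)) : Prop := ∀ u ∈ A.head?, ∀ v ∈ B.head?, u.2 < v.2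

open Classical in
theorem two_mul_card_filter_headLt (S : Finset α) (k : ℕ) :
    2 * #{P ∈ passagePairs 0 S k | HeadLt P.1 P.2} = #(passagePairs 0 S k) := by
  rw [← card_filter_add_card_filter_not (s := passagePairs 0 S k) (fun P => HeadLt P.1 P.2), two_mul]
  congr 1
  refine card_bij (fun P _ => P.swap) ?_ (fun _ _ _ _ h => Prod.swap_injective h) ?_
  · rintro ⟨A, B⟩ h
    simp only [mem_filter, mem_passagePairs, Prod.swap_prod_mk] at h ⊢
    obtain ⟨⟨hA, hB, hS, hk⟩, h⟩ := h
    refine ⟨⟨hB, hA, by rw [add_comm, hS], by rw [add_comm, hk]⟩, ?_⟩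
    obtain ⟨-, x, m, y, rfl, -⟩ := hA
    obtain ⟨-, x', m', y', rfl, -⟩ := hB
    simp only [HeadLt, List.head?_cons, Option.mem_def, Option.some.injEq, forall_eq'] at h ⊢
    exact not_lt.2 h.le
  · rintro ⟨B, A⟩ h
    simp only [mem_filter, mem_passagePairs] at h
    obtain ⟨⟨hB, hA, hS, hk⟩, h⟩ := h
    refine ⟨(A, B), ?_, rfl⟩
    simp only [mem_filter, mem_passagePairs]
    refine ⟨⟨hA, hB, by rw [add_comm, hS], by rw [add_comm, hk]⟩, ?_⟩
    obtain ⟨-, x, m, y, rfl, -⟩ := hA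
    obtain ⟨-, x', m', y', rfl, -⟩ := hB
    simp only [HeadLt, List.head?_cons, Option.mem_def, Option.some.injEq, forall_eq'] at h ⊢
    refine lt_of_le_of_ne (not_lt.1 h) ?_
    rintro rfl
    have hnd := S.nodup
    rw [← hS, Multiset.nodup_add] at hnd
    have hx : ∀ r : List (ℤ × α), x ∈ labels ((0, x) :: r) := fun r => by simp [labels]
    exact Multiset.disjoint_left.1 hnd.2.2 (hx _) (hx _)

open Classical in
theorem card_filter_headLt_one (S : Finset α) (k : ℕ) :
    #{P ∈ passagePairs 1 S k | HeadLt P.1 P.2} = #{P ∈ passagePairs 0 S k | HeadLt P.1 P.2} := by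
  set φ := List.map (transport 1 (RelEmbedding.refl (α := α) (· ≤ ·))) with hφ
  have hinj : Function.Injective φ := List.map_injective_iff.2 (transport_injective _ _)
  have hlab : ∀ A, labels (φ A) = labels A := fun A => by
    rw [hφ, labels_map_transport]; simp
  have hhead : ∀ A B, HeadLt (φ A) B ↔ HeadLt A B := by
    intro A B
    cases A <;> simp [HeadLt, hφ, transport]
  symm
  refine card_bij (fun P _ => (φ P.1, P.2)) ?_ ?_ ?_
  · rintro ⟨A, B⟩ h
    simp only [mem_filter, mem_passagePairs, hlab, hhead] at h ⊢
    rw [hφ, isFirstPassage_map_transport, flatCount_map_transport]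
    exact h
  · rintro ⟨A, B⟩ _ ⟨A', B'⟩ _ h
    simp only [Prod.mk.injEq] at h
    rw [hinj h.1, h.2]
  · rintro ⟨A, B⟩ h
    obtain ⟨A, rfl⟩ : ∃ A', φ A' = A := by
      have : A ∈ Set.range φ := by
        rw [hφ, Set.range_list_map]
        rintro ⟨h, a⟩ -
        exact ⟨(h - 1, a), by simp [transport]⟩
      exact this
    refine ⟨(A, B), ?_, rfl⟩
    simp only [mem_filter, mem_passagePairs, hlab, hhead] at h ⊢
    rw [hφ, isFirstPassage_map_transport, flatCount_map_transport] at h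
    exact h

/-- The height of the second vertex of a path. -/
def secondHeight : List (ℤ × α) → ℤ
  | _ :: v :: _ => v.1
  | _ => 0

theorem card_filter_secondHeight_neg_one (S : Finset α) (k : ℕ) :
    #{l ∈ firstPassages 0 S k | secondHeight l = -1} = if #S = 2 ∧ k = 0 then 1 else 0 := by
  have key : ∀ l : List (ℤ × α), (l ∈ firstPassages 0 S k ∧ secondHeight l = -1) ↔
      k = 0 ∧ ∃ x y, x < y ∧ S.val = {x, y} ∧ l = [(0, x), (-1, y)] := by
    intro l
    rw [mem_firstPassages]
    constructor
    · rintro ⟨⟨⟨hc, x, m, y, rfl, hm⟩, hS, rfl⟩, h⟩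
      cases m with
      | nil =>
        simp only [List.nil_append, List.isChain_cons_cons, StepRel] at hc
        refine ⟨by simp, x, y, ?_, ?_, by simp⟩
        · rcases hc.1 with h | h | h
          · exact h.2
          · simp at h
          · simp at h
        · rw [← hS]; rfl
      | cons v m =>
        have := hm v (by simp)
        simp only [List.cons_append, secondHeight] at h
        omega
    · rintro ⟨rfl, x, y, hxy, hS, rfl⟩
      refine ⟨⟨⟨?_, x, [], y, by simp, by simp⟩, by rw [hS]; rfl, by simp⟩, rfl⟩
      simp [StepRel, hxy]
  split_ifs with h
  · obtain ⟨hS, rfl⟩ := h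
    obtain ⟨x, y, hxy, rfl⟩ : ∃ x y, x < y ∧ S = {x, y} := by
      obtain ⟨x, y, hne, rfl⟩ := card_eq_two.1 hS
      rcases hne.lt_or_gt with h | h
      · exact ⟨x, y, h, rfl⟩
      · exact ⟨y, x, h, pair_comm _ _⟩
    have hval : ({x, y} : Finset α).val = {x, y} := by
      rw [insert_val_of_notMem (by simpa using hxy.ne)]
      rfl
    rw [card_eq_one]
    refine ⟨[(0, x), (-1, y)], ?_⟩
    ext l
    rw [mem_filter, key, mem_singleton]
    constructor
    · rintro ⟨-, x', y', hxy', hS', rfl⟩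
      rw [hval] at hS'
      have hx' : x' ∈ ({x, y} : Multiset α) := by simp [hS']
      have hy' : y' ∈ ({x, y} : Multiset α) := by simp [hS']
      simp only [Multiset.insert_eq_cons, Multiset.mem_cons, Multiset.mem_singleton] at hx' hy'
      rcases hx' with rfl | rfl <;> rcases hy' with rfl | rfl
      · exact (lt_irrefl _ hxy').elim
      · rfl
      · exact (lt_asymm hxy hxy').elim
      · exact (lt_irrefl _ hxy').elim
    · rintro rfl
      exact ⟨rfl, x, y, hxy, hval, rfl⟩
  · rw [card_eq_zero, filter_eq_empty_iff]
    intro l hl hs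
    obtain ⟨rfl, x, y, -, hS, -⟩ := (key l).1 ⟨hl, hs⟩
    exact h ⟨by rw [Finset.card_def, hS]; rfl, rfl⟩

theorem filter_secondHeight_zero (S : Finset α) (k : ℕ) :
    {l ∈ firstPassages 0 S (k + 1) | secondHeight l = 0} =
      S.biUnion fun a => (firstPassages 0 (S.erase a) k).image (List.cons (0, a)) := by
  ext l
  simp only [mem_filter, mem_firstPassages, mem_biUnion, mem_image]
  constructor
  · rintro ⟨⟨⟨hc, x, m, y, rfl, hm⟩, hS, hk⟩, h⟩
    have hx : x ∈ S := by
      rw [← Finset.mem_val, ← hS]; simp [labels]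
    cases m with
    | nil => simp [secondHeight] at h
    | cons v m =>
      obtain ⟨h₁, z⟩ := v
      simp only [List.cons_append, secondHeight] at h
      subst h
      simp only [List.cons_append, flatCount_cons_cons, List.isChain_cons_cons] at hk hc
      refine ⟨x, hx, (0, z) :: (m ++ [(0 - 1, y)]),
        ⟨⟨hc.2, z, m, y, rfl, fun v hv => hm v (by simp [hv])⟩, ?_, ?_⟩, by simp⟩
      · rw [Finset.erase_val, ← hS]
        simp [labels]
      · simp at hk ⊢
        omega
  · rintro ⟨x, hx, l, ⟨⟨hc, z, m, y, rfl, hm⟩, hS, hk⟩, rfl⟩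
    refine ⟨⟨⟨?_, x, (0, z) :: m, y, by simp, ?_⟩, ?_, ?_⟩, rfl⟩
    · rw [List.isChain_cons_cons]
      exact ⟨Or.inr (Or.inl rfl), hc⟩
    · intro v hv
      rcases List.mem_cons.1 hv with rfl | hv
      · simp
      · exact hm v hv
    · rw [Finset.erase_val] at hS
      have : labels ((0, x) :: (0, z) :: (m ++ [(0 - 1, y)])) =
        x ::ₘ labels ((0, z) :: (m ++ [(0 - 1, y)])) := rfl
      rw [this, hS, Multiset.cons_erase hx]
    · rw [flatCount_cons_cons, hk]
      simp [add_comm]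

theorem card_filter_secondHeight_zero (S : Finset α) (k : ℕ) :
    #{l ∈ firstPassages 0 S k | secondHeight l = 0} =
      if k = 0 then 0 else #S * firstPassageCount (#S - 1) (k - 1) := by
  cases k with
  | zero =>
    rw [if_pos rfl, card_eq_zero, filter_eq_empty_iff]
    intro l hl hs
    rw [mem_firstPassages] at hl
    obtain ⟨⟨-, x, m, y, rfl, -⟩, -, hk⟩ := hl
    cases m with
    | nil => simp [secondHeight] at hs
    | cons v m =>
      simp only [List.cons_append, secondHeight] at hs
      simp [hs] at hk
  | succ k =>
    rw [if_neg (by omega), filter_secondHeight_zero, card_biUnion]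
    · rw [sum_congr rfl (g := fun _ => firstPassageCount (#S - 1) k), sum_const, smul_eq_mul]
      · rfl
      · intro a ha
        rw [card_image_of_injective _ List.cons_injective, card_firstPassages,
          card_erase_of_mem ha]
    · intro a _ b _ hab
      rw [Function.onFun, Finset.disjoint_left]
      intro l h h'
      simp only [mem_image] at h h'
      obtain ⟨l₁, -, rfl⟩ := h
      obtain ⟨l₂, -, h⟩ := h'
      simp only [List.cons.injEq, Prod.mk.injEq] at h
      exact hab h.1.2.symm

theorem append_cons_inj_of_height {c : ℤ} {l₁ l₂ r₁ r₂ : List (ℤ × α)} {u v : ℤ × α}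
    (h₁ : ∀ w ∈ l₁, c < w.1) (h₂ : ∀ w ∈ l₂, c < w.1) (hu : u.1 ≤ c) (hv : v.1 ≤ c)
    (h : l₁ ++ u :: r₁ = l₂ ++ v :: r₂) : l₁ = l₂ ∧ u :: r₁ = v :: r₂ := by
  induction l₁ generalizing l₂ with
  | nil =>
    cases l₂ with
    | nil => exact ⟨rfl, h⟩
    | cons w l₂ =>
      simp only [List.nil_append, List.cons_append, List.cons.injEq] at h
      have := h₂ w (by simp)
      rw [← h.1] at this
      omega
  | cons w l₁ ih =>
    cases l₂ with
    | nil =>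
      simp only [List.nil_append, List.cons_append, List.cons.injEq] at h
      have := h₁ w (by simp)
      rw [h.1] at this
      omega
    | cons w' l₂ =>
      simp only [List.cons_append, List.cons.injEq] at h
      obtain ⟨rfl, h⟩ := h
      obtain ⟨rfl, h'⟩ := ih (fun w hw => h₁ w (by simp [hw])) (fun w hw => h₂ w (by simp [hw])) h
      exact ⟨rfl, h'⟩

/-- Reversing the first excursion: gluing `A` and `B` after reversing `A`. -/
theorem isFirstPassage_reverse_append {A B : List (ℤ × α)} (hA : IsFirstPassage 1 A)
    (hB : IsFirstPassage 0 B) (h : HeadLt A B) :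
    IsFirstPassage 0 (A.reverse ++ B) ∧ secondHeight (A.reverse ++ B) = 1 ∧
      flatCount (A.reverse ++ B) = flatCount A + flatCount B := by
  obtain ⟨hcA, a, m, x, rfl, hm⟩ := hA
  obtain ⟨hcB, b, m', y, rfl, hm'⟩ := hB
  have hab : a < b := by simpa [HeadLt] using h
  have hrel : StepRel ((1 : ℤ), a) ((0 : ℤ), b) := Or.inl ⟨rfl, hab⟩
  have hcA' := isChain_stepRel_reverse.2 hcA
  refine ⟨⟨?_, x, m.reverse ++ (1, a) :: (0, b) :: m', y, by simp, ?_⟩, ?_, ?_⟩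
  · rw [List.isChain_append]
    refine ⟨hcA', hcB, ?_⟩
    simp only [List.getLast?_reverse, List.head?_cons, Option.mem_def, Option.some.injEq,
      forall_eq']
    exact hrel
  · intro v hv
    simp only [List.mem_append, List.mem_reverse, List.mem_cons] at hv
    rcases hv with hv | rfl | rfl | hv
    · have := hm v hv
      omega
    · simp
    · simp
    · exact hm' v hv
  · rcases List.eq_nil_or_concat m with rfl | ⟨m₀, w, rfl⟩
    · simp [secondHeight]
    · have hw := hm w (by simp)
      have hcA'' := hcA'
      simp [StepRel] at hcA''
      have e : secondHeight (((1, a) :: (m₀ ++ [w] ++ [((1 : ℤ) - 1, x)])).reverse ++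
        (0, b) :: (m' ++ [((0 : ℤ) - 1, y)])) = w.1 := by simp [secondHeight]
      rw [List.concat_eq_append, e]
      omega
  · rw [List.reverse_cons, List.append_assoc, List.singleton_append, flatCount_append_cons,
      flatCount_cons_cons, if_neg (by simp), zero_add, ← List.reverse_cons, flatCount_reverse]

theorem exists_reverse_append {l : List (ℤ × α)} (hl : IsFirstPassage 0 l)
    (h : secondHeight l = 1) :
    ∃ A B, IsFirstPassage 1 A ∧ IsFirstPassage 0 B ∧ HeadLt A B ∧ A.reverse ++ B = l := by
  obtain ⟨hc, x, m, y, rfl, hm⟩ := hl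
  cases m with
  | nil => simp [secondHeight] at h
  | cons v m =>
    simp only [List.cons_append, secondHeight] at h
    obtain ⟨C, u, r, hCr, hC, hu⟩ :=
      exists_append_cons_of_height (c := 0) (l := m ++ [(0 - 1, y)]) ⟨(0 - 1, y), by simp, by simp⟩
    obtain ⟨C', w, hCw⟩ : ∃ C' w, v :: C = C' ++ [w] := by
      rcases List.eq_nil_or_concat (v :: C) with h | ⟨C', w, h⟩
      · simp at h
      · exact ⟨C', w, by rw [h, List.concat_eq_append]⟩
    have hpos : ∀ z ∈ C' ++ [w], 0 < z.1 := by
      rw [← hCw]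
      intro z hz
      rcases List.mem_cons.1 hz with rfl | hz
      · omega
      · exact hC z hz
    have hl : (0, x) :: (v :: m ++ [(0 - 1, y)]) = ((0, x) :: C') ++ w :: u :: r := by
      rw [List.cons_append, hCr, ← List.cons_append, hCw]
      simp
    rw [hl] at hc ⊢
    rw [List.isChain_append_cons_cons] at hc
    obtain ⟨hc₁, hwu, hc₂⟩ := hc
    have hw := hpos w (by simp)
    have hwu' : w.1 = 1 ∧ u.1 = 0 ∧ w.2 < u.2 := by
      rcases hwu with h | h | h
      · exact ⟨by omega, by omega, h.2⟩
      · omega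
      · omega
    obtain ⟨h₁, a⟩ := w
    obtain ⟨h₂, b⟩ := u
    simp only at hwu'
    obtain ⟨rfl, rfl, hab⟩ := hwu'
    obtain ⟨r', rfl, rfl⟩ : ∃ r', r = r' ++ [(0 - 1, y)] ∧ m = C ++ (0, b) :: r' := by
      rcases List.eq_nil_or_concat r with rfl | ⟨r', z, rfl⟩
      · have := (List.append_inj' hCr rfl).2
        simp at this
      · rw [List.concat_eq_append] at hCr ⊢
        have e : C ++ (0, b) :: (r' ++ [z]) = (C ++ (0, b) :: r') ++ [z] := by simp
        rw [e] at hCr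
        obtain ⟨h₁, h₂⟩ := List.append_inj' hCr rfl
        exact ⟨r', by rw [h₂], h₁⟩
    have hA : (0, x) :: C' ++ [(1, a)] = ((1, a) :: (C'.reverse ++ [((1 : ℤ) - 1, x)])).reverse := by
      simp
    rw [hA, isChain_stepRel_reverse] at hc₁
    refine ⟨(1, a) :: (C'.reverse ++ [(1 - 1, x)]), (0, b) :: (r' ++ [(0 - 1, y)]),
      ⟨hc₁, a, C'.reverse, x, rfl, ?_⟩, ⟨hc₂, b, r', y, rfl, ?_⟩, ?_, ?_⟩
    · intro z hz
      have := hpos z (by simp [List.mem_reverse.1 hz])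
      omega
    · intro z hz
      exact hm z (by simp [hz])
    · simpa [HeadLt] using hab
    · simp

open Classical in
theorem card_filter_secondHeight_one (S : Finset α) (k : ℕ) :
    #{l ∈ firstPassages 0 S k | secondHeight l = 1} =
      #{P ∈ passagePairs 1 S k | HeadLt P.1 P.2} := by
  symm
  refine card_bij (fun P _ => P.1.reverse ++ P.2) ?_ ?_ ?_
  · rintro ⟨A, B⟩ h
    simp only [mem_filter, mem_passagePairs, mem_firstPassages] at h ⊢
    obtain ⟨⟨hA, hB, hS, hk⟩, h⟩ := h
    obtain ⟨h₁, h₂, h₃⟩ := isFirstPassage_reverse_append hA hB h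
    exact ⟨⟨h₁, by rw [labels_append, labels_reverse, hS], h₃.trans hk⟩, h₂⟩
  · rintro ⟨A, B⟩ h ⟨A', B'⟩ h' e
    simp only [mem_filter, mem_passagePairs] at h h' e
    obtain ⟨⟨⟨-, a, m, x, rfl, hm⟩, ⟨-, b, n, y, rfl, -⟩, -⟩, -⟩ := h
    obtain ⟨⟨⟨-, a', m', x', rfl, hm'⟩, ⟨-, b', n', y', rfl, -⟩, -⟩, -⟩ := h'
    simp only [List.reverse_cons, List.reverse_append, List.reverse_nil, List.nil_append,
      List.cons_append, List.cons.injEq] at e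
    obtain ⟨hx, e⟩ := e
    have hgt : ∀ (c : α) (l : List (ℤ × α)), (∀ v ∈ l, 1 ≤ v.1) →
        ∀ v ∈ l.reverse ++ [(1, c)], 0 < v.1 := by
      intro c l hl v hv
      rcases List.mem_append.1 hv with hv | hv
      · have := hl v (List.mem_reverse.1 hv)
        omega
      · rw [List.mem_singleton.1 hv]
        simp
    obtain ⟨e₁, e₂⟩ := append_cons_inj_of_height (hgt _ _ hm) (hgt _ _ hm') le_rfl le_rfl e
    obtain ⟨e₃, e₄⟩ := List.append_inj' e₁ rfl
    rw [e₂, List.reverse_injective e₃, hx, List.singleton_injective e₄]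
  · intro l hl
    simp only [mem_filter, mem_firstPassages] at hl
    obtain ⟨⟨hl, hS, hk⟩, h⟩ := hl
    obtain ⟨A, B, hA, hB, hAB, rfl⟩ := exists_reverse_append hl h
    refine ⟨(A, B), ?_, rfl⟩
    rw [labels_append, labels_reverse] at hS
    rw [(isFirstPassage_reverse_append hA hB hAB).2.2] at hk
    simp only [mem_filter, mem_passagePairs]
    exact ⟨⟨hA, hB, hS, hk⟩, hAB⟩

theorem secondHeight_mem {S : Finset α} {k : ℕ} {l : List (ℤ × α)}
    (hl : l ∈ firstPassages 0 S k) : secondHeight l ∈ ({-1, 0, 1} : Finset ℤ) := by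
  rw [mem_firstPassages] at hl
  obtain ⟨⟨hc, x, m, y, rfl, -⟩, -⟩ := hl
  cases m with
  | nil => simp [secondHeight]
  | cons v m =>
    rw [List.cons_append, List.isChain_cons_cons] at hc
    have := hc.1
    simp only [StepRel] at this
    simp only [List.cons_append, secondHeight, mem_insert, mem_singleton]
    omega

theorem two_mul_firstPassageCount (n k : ℕ) :
    2 * firstPassageCount n k = 2 * (if n = 2 ∧ k = 0 then 1 else 0) +
      2 * (if k = 0 then 0 else n * firstPassageCount (n - 1) (k - 1)) +
      ∑ x ∈ antidiagonal n, n.choose x.1 *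
        ∑ y ∈ antidiagonal k, firstPassageCount x.1 y.1 * firstPassageCount x.2 y.2 := by
  classical
  have h0 := card_filter_secondHeight_neg_one (univ : Finset (Fin n)) k
  have h1 := card_filter_secondHeight_zero (univ : Finset (Fin n)) k
  have h2 := card_filter_secondHeight_one (univ : Finset (Fin n)) k
  rw [card_filter_headLt_one] at h2
  have h3 := two_mul_card_filter_headLt (univ : Finset (Fin n)) k
  rw [card_passagePairs] at h3
  simp only [card_univ, Fintype.card_fin] at h0 h1 h3
  rw [firstPassageCount, card_eq_sum_card_fiberwise
    (f := (secondHeight : List (ℤ × Fin n) → ℤ)) (t := {-1, 0, 1})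
    (fun l hl => secondHeight_mem hl), sum_insert (by decide), sum_insert (by decide),
    sum_singleton, h0, h1, h2, mul_add, mul_add, h3, add_assoc]

end Lists
theorem sum_choose_mul_choose_antidiagonal (r s k : ℕ) :
    ∑ y ∈ antidiagonal k, (r + y.1).choose y.1 * (s + y.2).choose y.2 =
      (r + s + 1 + k).choose k := by
  have h := congrArg (fun u : (PowerSeries ℚ)ˣ => PowerSeries.coeff k (u : PowerSeries ℚ))
    (PowerSeries.invOneSubPow_add ℚ (r + 1) (s + 1))
  have e : r + 1 + (s + 1) = (r + s + 1) + 1 := by ring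
  rw [e] at h
  simp only [Units.val_mul, PowerSeries.invOneSubPow_val_succ_eq_mk_add_choose, PowerSeries.coeff_mul,
    PowerSeries.coeff_mk] at h
  have hs : ∀ a b : ℕ, (a + b).choose b = (a + b).choose a := fun a b => (Nat.choose_symm_add).symm
  simp only [hs]
  rw [add_comm _ k, Nat.choose_symm_add, add_comm k]
  exact_mod_cast h.symm

/-- The Taylor coefficients of `1 - √(1 - t²)`. -/
def sqrtCoeff (m : ℕ) : ℚ :=
  if Even m ∧ 2 ≤ m then (catalan (m / 2 - 1) : ℚ) / 2 ^ (m - 1) else 0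

theorem sqrtCoeff_two_mul_add_two (j : ℕ) :
    sqrtCoeff (2 * j + 2) = (catalan j : ℚ) / 2 ^ (2 * j + 1) := by
  have h : (2 * j + 2) / 2 - 1 = j := by omega
  rw [sqrtCoeff, if_pos ⟨by grind, by omega⟩, h]
  rfl

theorem sqrtCoeff_eq_zero {m : ℕ} (h : ¬ (Even m ∧ 2 ≤ m)) : sqrtCoeff m = 0 := if_neg h

theorem sum_sqrtCoeff_mul (m : ℕ) :
    ∑ x ∈ antidiagonal m, sqrtCoeff x.1 * sqrtCoeff x.2 =
      if m = 2 then 0 else 2 * sqrtCoeff m := by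
  by_cases hm : ∃ j, m = 2 * j + 4
  · obtain ⟨j, rfl⟩ := hm
    rw [if_neg (by omega), show 2 * j + 4 = 2 * (j + 1) + 2 by ring, sqrtCoeff_two_mul_add_two,
      catalan_succ']
    push_cast
    rw [sum_div, mul_sum]
    symm
    apply sum_of_injOn (fun x => (2 * x.1 + 2, 2 * x.2 + 2))
    · rintro ⟨a, b⟩ _ ⟨c, d⟩ _ h
      simp only [Prod.mk.injEq] at h ⊢
      omega
    · rintro ⟨a, b⟩ h
      simp only [mem_coe, HasAntidiagonal.mem_antidiagonal] at h ⊢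
      omega
    · rintro ⟨a, b⟩ h hn
      simp only [HasAntidiagonal.mem_antidiagonal, Set.mem_image, mem_coe, Prod.exists, Prod.mk.injEq,
        not_exists, not_and] at h hn
      by_cases ha : Even a ∧ 2 ≤ a
      · by_cases hb : Even b ∧ 2 ≤ b
        · obtain ⟨⟨u, rfl⟩, hu⟩ := ha
          obtain ⟨⟨v, rfl⟩, hv⟩ := hb
          exact (hn (u - 1) (v - 1) (by omega) (by omega) (by omega)).elim
        · simp [sqrtCoeff_eq_zero hb]
      · simp [sqrtCoeff_eq_zero ha]
    · rintro ⟨a, b⟩ h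
      rw [HasAntidiagonal.mem_antidiagonal] at h
      simp only at h
      subst h
      simp only [sqrtCoeff_two_mul_add_two]
      field_simp
      ring
  · have h0 : (if m = 2 then (0 : ℚ) else 2 * sqrtCoeff m) = 0 := by
      split_ifs with h
      · rfl
      · rw [sqrtCoeff_eq_zero, mul_zero]
        rintro ⟨⟨u, rfl⟩, hu⟩
        exact hm ⟨u - 2, by omega⟩
    rw [h0]
    refine sum_eq_zero fun x hx => ?_
    rw [HasAntidiagonal.mem_antidiagonal] at hx
    by_cases ha : Even x.1 ∧ 2 ≤ x.1
    · by_cases hb : Even x.2 ∧ 2 ≤ x.2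
      · obtain ⟨⟨u, hu⟩, hu'⟩ := ha
        obtain ⟨⟨v, hv⟩, hv'⟩ := hb
        exact (hm ⟨u + v - 2, by omega⟩).elim
      · rw [sqrtCoeff_eq_zero hb, mul_zero]
    · rw [sqrtCoeff_eq_zero ha, zero_mul]

theorem factorial_mul_sqrtCoeff {m : ℕ} (hm : 2 ≤ m) :
    (m.factorial : ℚ) * sqrtCoeff m =
      if Even m then ((m - 1).doubleFactorial * (m - 3).doubleFactorial : ℚ) else 0 := by
  split_ifs with he
  · obtain ⟨j, rfl⟩ : ∃ j, m = 2 * j + 2 := by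
      obtain ⟨u, rfl⟩ := he
      exact ⟨u - 1, by omega⟩
    rw [sqrtCoeff_two_mul_add_two, show 2 * j + 2 - 1 = 2 * j + 1 by omega,
      Nat.factorial_eq_mul_doubleFactorial, show 2 * j + 1 + 1 = 2 * (j + 1) by ring,
      Nat.doubleFactorial_two_mul, Nat.factorial_succ]
    have key : catalan j * (j + 1).factorial = 2 ^ j * (2 * j + 2 - 3).doubleFactorial := by
      have h1 := succ_mul_catalan_eq_centralBinom j
      have h2 := Nat.centralBinom_eq_two_mul_choose j
      have h3 : (2 * j).factorial = 2 ^ j * j.factorial * (2 * j + 2 - 3).doubleFactorial := by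
        cases j with
        | zero => simp
        | succ i =>
          rw [show 2 * (i + 1) = (2 * i + 1) + 1 by ring, Nat.factorial_eq_mul_doubleFactorial,
            show 2 * i + 1 + 1 = 2 * (i + 1) by ring, Nat.doubleFactorial_two_mul,
            show 2 * (i + 1) + 2 - 3 = 2 * i + 1 by omega]
      have h4 := Nat.choose_mul_factorial_mul_factorial (show j ≤ 2 * j by omega)
      rw [show 2 * j - j = j by omega, ← h2, ← h1, h3] at h4
      have : 0 < j.factorial := Nat.factorial_pos j
      rw [Nat.factorial_succ]
      apply Nat.eq_of_mul_eq_mul_right this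
      linarith
    rw [Nat.factorial_succ] at key
    have key' : (catalan j : ℚ) * ((j + 1) * j.factorial)
        = 2 ^ j * (2 * j + 2 - 3).doubleFactorial := by exact_mod_cast key
    push_cast
    field_simp
    linear_combination (2 ^ (j + 1) : ℚ) * key'
  · rw [sqrtCoeff_eq_zero (fun h => he h.1), mul_zero]

/-- Coefficients of `1 - z t - √((1 - z t)² - t²)`. -/
def passageCoeff (n k : ℕ) : ℚ := (n - 2).choose k * sqrtCoeff (n - k)

theorem passageCoeff_eq_zero {n k : ℕ} (h : n < k + 2) : passageCoeff n k = 0 := by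
  rw [passageCoeff]
  by_cases hk : n - 2 < k
  · rw [Nat.choose_eq_zero_of_lt hk]; simp
  · rw [sqrtCoeff_eq_zero (by omega), mul_zero]

theorem passageCoeff_add (r k : ℕ) :
    passageCoeff (r + 2 + k) k = (r + k).choose k * sqrtCoeff (r + 2) := by
  rw [passageCoeff, show r + 2 + k - 2 = r + k by omega, show r + 2 + k - k = r + 2 by omega]

theorem sum_passageCoeff_mul (m k : ℕ) :
    ∑ x ∈ antidiagonal (m + 3 + k), ∑ y ∈ antidiagonal k,
      passageCoeff x.1 y.1 * passageCoeff x.2 y.2 =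
      2 * ((m + k).choose k * sqrtCoeff (m + 3)) := by
  rw [sum_comm]
  have inner : ∀ y ∈ antidiagonal k, ∑ x ∈ antidiagonal (m + 3 + k),
      passageCoeff x.1 y.1 * passageCoeff x.2 y.2 =
      ∑ w ∈ antidiagonal (m + 3), passageCoeff (w.1 + y.1) y.1 * passageCoeff (w.2 + y.2) y.2 := by
    rintro ⟨j, j'⟩ hy
    rw [HasAntidiagonal.mem_antidiagonal] at hy
    simp only at hy ⊢
    symm
    apply sum_of_injOn (fun x => (x.1 + j, x.2 + j'))
    · rintro ⟨a, b⟩ _ ⟨c, d⟩ _ h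
      simp only [Prod.mk.injEq] at h ⊢
      omega
    · rintro ⟨a, b⟩ h
      simp only [mem_coe, HasAntidiagonal.mem_antidiagonal] at h ⊢
      omega
    · rintro ⟨a, b⟩ h hn
      simp only [HasAntidiagonal.mem_antidiagonal, Set.mem_image, mem_coe, Prod.exists, Prod.mk.injEq,
        not_exists, not_and] at h hn ⊢
      by_cases ha : a < j + 2
      · rw [passageCoeff_eq_zero ha, zero_mul]
      by_cases hb : b < j' + 2
      · rw [passageCoeff_eq_zero hb, mul_zero]
      exact (hn (a - j) (b - j') (by omega) (by omega) (by omega)).elim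
    · rintro ⟨a, b⟩ h
      rfl
  rw [sum_congr rfl inner, sum_comm]
  have outer : ∀ w ∈ antidiagonal (m + 3), ∑ y ∈ antidiagonal k,
      passageCoeff (w.1 + y.1) y.1 * passageCoeff (w.2 + y.2) y.2 =
      (m + k).choose k * (sqrtCoeff w.1 * sqrtCoeff w.2) := by
    rintro ⟨a, b⟩ hw
    rw [HasAntidiagonal.mem_antidiagonal] at hw
    simp only at hw ⊢
    by_cases ha : a < 2
    · rw [sqrtCoeff_eq_zero (m := a) (by omega)]
      simp only [zero_mul, mul_zero]
      refine sum_eq_zero fun y _ => ?_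
      rw [passageCoeff_eq_zero (n := a + y.1) (by omega), zero_mul]
    by_cases hb : b < 2
    · rw [sqrtCoeff_eq_zero (m := b) (by omega)]
      simp only [mul_zero]
      refine sum_eq_zero fun y _ => ?_
      rw [passageCoeff_eq_zero (n := b + y.2) (by omega), mul_zero]
    obtain ⟨r, rfl⟩ : ∃ r, a = r + 2 := ⟨a - 2, by omega⟩
    obtain ⟨s, rfl⟩ : ∃ s, b = s + 2 := ⟨b - 2, by omega⟩
    have hv := sum_choose_mul_choose_antidiagonal r s k
    rw [show r + s + 1 + k = m + k by omega] at hv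
    rw [← hv]
    push_cast
    rw [sum_mul]
    refine sum_congr rfl fun y _ => ?_
    rw [passageCoeff_add, passageCoeff_add]
    ring
  rw [sum_congr rfl outer, ← mul_sum, sum_sqrtCoeff_mul, if_neg (by omega)]
  ring

theorem passageCoeff_rec (n k : ℕ) :
    2 * passageCoeff n k = (if n = 2 ∧ k = 0 then 1 else 0) +
      2 * (if n = 0 ∨ k = 0 then 0 else passageCoeff (n - 1) (k - 1)) +
      ∑ x ∈ antidiagonal n, ∑ y ∈ antidiagonal k,
        passageCoeff x.1 y.1 * passageCoeff x.2 y.2 := by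
  by_cases hnk : n < k + 3
  · have hs : ∑ x ∈ antidiagonal n, ∑ y ∈ antidiagonal k,
        passageCoeff x.1 y.1 * passageCoeff x.2 y.2 = 0 := by
      refine sum_eq_zero fun x hx => sum_eq_zero fun y hy => ?_
      rw [HasAntidiagonal.mem_antidiagonal] at hx hy
      by_cases ha : x.1 < y.1 + 2
      · rw [passageCoeff_eq_zero ha, zero_mul]
      · rw [passageCoeff_eq_zero (n := x.2) (by omega), mul_zero]
    rw [hs]
    by_cases hn2 : n = k + 2
    · subst hn2
      have h2 : sqrtCoeff 2 = 1 / 2 := by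
        have := sqrtCoeff_two_mul_add_two 0
        simpa using this
      cases k with
      | zero => simp [passageCoeff, h2]
      | succ k => simp [passageCoeff]
    · rw [passageCoeff_eq_zero (by omega), if_neg (by omega)]
      split_ifs with h
      · simp
      · rw [passageCoeff_eq_zero (by omega)]; simp
  · obtain ⟨m, rfl⟩ : ∃ m, n = m + 3 + k := ⟨n - k - 3, by omega⟩
    rw [sum_passageCoeff_mul, if_neg (by omega), passageCoeff,
      show m + 3 + k - 2 = m + k + 1 by omega, show m + 3 + k - k = m + 3 by omega]
    cases k with
    | zero => simp
    | succ k =>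
      rw [if_neg (by omega), passageCoeff, show m + 3 + (k + 1) - 1 - 2 = m + (k + 1) by omega,
        show m + 3 + (k + 1) - 1 - (k + 1 - 1) = m + 3 by omega, Nat.choose_succ_succ]
      push_cast
      ring

theorem firstPassageCount_eq (n k : ℕ) :
    (firstPassageCount n k : ℚ) = n.factorial * passageCoeff n k := by
  induction n using Nat.strong_induction_on generalizing k with
  | _ n ih =>
  have hrec := congrArg (Nat.cast (R := ℚ)) (two_mul_firstPassageCount n k)
  push_cast at hrec
  have hcount0 : ∀ k, firstPassageCount 0 k = 0 := by
    intro k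
    rw [firstPassageCount, card_eq_zero, eq_empty_iff_forall_notMem]
    intro l hl
    rw [mem_firstPassages] at hl
    obtain ⟨⟨-, x, -⟩, -⟩ := hl
    exact x.elim0
  have hcoeff0 : ∀ k, passageCoeff 0 k = 0 := fun k => passageCoeff_eq_zero (by omega)
  have hconv : ∑ x ∈ antidiagonal n, (n.choose x.1 : ℚ) *
      ∑ y ∈ antidiagonal k, (firstPassageCount x.1 y.1 : ℚ) * firstPassageCount x.2 y.2 =
      n.factorial * ∑ x ∈ antidiagonal n, ∑ y ∈ antidiagonal k,
        passageCoeff x.1 y.1 * passageCoeff x.2 y.2 := by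
    rw [mul_sum]
    refine sum_congr rfl fun x hx => ?_
    rw [HasAntidiagonal.mem_antidiagonal] at hx
    rw [mul_sum, mul_sum]
    refine sum_congr rfl fun y _ => ?_
    by_cases h1 : x.1 = 0
    · rw [h1, hcount0, hcoeff0]; simp
    by_cases h2 : x.2 = 0
    · rw [h2, hcount0, hcoeff0]; simp
    rw [ih x.1 (by omega), ih x.2 (by omega), ← hx,
      ← Nat.add_choose_mul_factorial_mul_factorial, Nat.choose_symm_add]
    push_cast
    ring
  rw [hconv] at hrec
  have hflat : (if k = 0 then (0 : ℚ) else n * firstPassageCount (n - 1) (k - 1)) =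
      n.factorial * (if n = 0 ∨ k = 0 then 0 else passageCoeff (n - 1) (k - 1)) := by
    by_cases hk : k = 0
    · simp [hk]
    by_cases hn : n = 0
    · simp [hn]
    rw [if_neg hk, if_neg (by tauto), ih (n - 1) (by omega), ← Nat.mul_factorial_pred hn]
    push_cast
    ring
  have hbase : 2 * (if n = 2 ∧ k = 0 then (1 : ℚ) else 0) =
      n.factorial * (if n = 2 ∧ k = 0 then 1 else 0) := by
    split_ifs with h
    · rw [h.1]; norm_num [Nat.factorial]
    · simp
  have hc := passageCoeff_rec n k
  rw [hflat, hbase] at hrec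
  linear_combination hrec / 2 - (n.factorial : ℚ) / 2 * hc

theorem psum_zero (n : ℕ) (p : Fin (n - 1) → ℤ) : psum n p 0 = 0 := by
  simp [psum]

theorem psum_succ (n : ℕ) (p : Fin (n - 1) → ℤ) (i : Fin (n - 1)) :
    psum n p (i + 1) = psum n p i + p i := by
  have h : univ.filter (fun j : Fin (n - 1) => j.1 < i + 1) =
      insert i (univ.filter fun j : Fin (n - 1) => j.1 < i) := by
    ext j
    simp only [mem_filter, mem_univ, true_and, mem_insert, Fin.ext_iff]
    omega
  rw [psum, psum, h, sum_insert (by simp), add_comm]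

theorem labels_ofFn {α : Type*} {n : ℕ} (g : Fin n → ℤ × α) :
    labels (List.ofFn g) = univ.val.map fun i => (g i).2 := by
  rw [Fin.univ_val_map, labels, List.map_ofFn]
  rfl

theorem flatCount_ofFn {α : Type*} {n : ℕ} (g : Fin (n + 1) → ℤ × α) :
    flatCount (List.ofFn g) = #{i : Fin n | (g i.castSucc).1 = (g i.succ).1} := by
  induction n with
  | zero => simp
  | succ n ih =>
    rw [List.ofFn_succ, List.ofFn_succ, flatCount_cons_cons,
      ← List.ofFn_succ (f := fun i => g i.succ), ih, Fin.card_filter_univ_succ]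
    by_cases h : (g 0).1 = (g (Fin.succ 0)).1
    · rw [if_pos h, if_pos (show (g (Fin.castSucc 0)).1 = (g (Fin.succ 0)).1 from h), add_comm]
      rfl
    · rw [if_neg h, if_neg (show ¬(g (Fin.castSucc 0)).1 = (g (Fin.succ 0)).1 from h), zero_add]
      rfl

theorem isFirstPassage_ofFn {α : Type*} [LinearOrder α] {n : ℕ} (g : Fin (n + 2) → ℤ × α) :
    IsFirstPassage 0 (List.ofFn g) ↔
      (∀ i : Fin (n + 1), StepRel (g i.castSucc) (g i.succ)) ∧ (g 0).1 = 0 ∧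
        (g (Fin.last _)).1 = -1 ∧ ∀ i : Fin (n + 1), 0 ≤ (g i.castSucc).1 := by
  rw [IsFirstPassage, List.isChain_ofFn]
  refine and_congr ⟨fun h i => h i (by omega), fun h i hi => h ⟨i, by omega⟩⟩ ?_
  rw [List.ofFn_succ, List.ofFn_succ', List.concat_eq_append]
  constructor
  · rintro ⟨x, m, y, h, hm⟩
    simp only [List.cons.injEq] at h
    obtain ⟨h0, h⟩ := h
    obtain ⟨h₁, h₂⟩ := List.append_inj' h rfl
    simp only [List.cons.injEq, and_true, Fin.succ_last] at h₂
    refine ⟨by rw [h0], by rw [h₂]; rfl, ?_⟩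
    intro i
    cases i using Fin.cases with
    | zero => simp [h0]
    | succ i =>
      refine hm _ ?_
      rw [← h₁, List.mem_ofFn]
      exact ⟨i, rfl⟩
  · rintro ⟨h0, h1, hg⟩
    refine ⟨(g 0).2, List.ofFn fun i : Fin n => g i.castSucc.succ, (g (Fin.last _)).2, ?_, ?_⟩
    · congr 1
      · exact Prod.ext h0 rfl
      · congr 2
        exact Prod.ext h1 rfl
    · intro v hv
      obtain ⟨i, rfl⟩ := List.mem_ofFn.1 hv
      exact hg i.succ

/-- The list of vertices of a word and a permutation. -/
def vertices (n : ℕ) (p : Fin (n - 1) → ℤ) (σ : Equiv.Perm (Fin n)) : List (ℤ × Fin n) :=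
  List.ofFn fun i => (psum n p i, σ i)

theorem vertices_mem_firstPassages {n k : ℕ} {p : Fin (n + 2 - 1) → ℤ}
    {σ : Equiv.Perm (Fin (n + 2))} :
    vertices (n + 2) p σ ∈ firstPassages 0 univ k ↔
      IsMotzkinPath (n + 2) p σ ∧ horizCount (n + 2) p = k := by
  have hps := psum_succ (n + 2) p
  rw [mem_firstPassages, vertices, isFirstPassage_ofFn, labels_ofFn, flatCount_ofFn]
  have h1 : univ.val.map (fun i => σ i) = univ.val := by
    have := congrArg Finset.val (Finset.map_univ_equiv σ)
    rwa [Finset.map_val] at this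
  have h2 : #{i : Fin (n + 1) | psum (n + 2) p i.castSucc = psum (n + 2) p i.succ} =
      horizCount (n + 2) p := by
    rw [horizCount]
    congr 1
    ext i
    have := hps i
    simp only [mem_filter, mem_univ, true_and, Fin.val_castSucc, Fin.val_succ]
    omega
  simp only [h1, h2, true_and]
  refine and_congr_left fun _ => ?_
  have hp : ∀ i : Fin (n + 1), StepRel (psum (n + 2) p i.castSucc, σ i.castSucc)
      (psum (n + 2) p i.succ, σ i.succ) ↔ (p i = -1 ∧ σ i.castSucc < σ i.succ) ∨ p i = 0 ∨
        (p i = 1 ∧ σ i.succ < σ i.castSucc) := by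
    intro i
    have := hps i
    simp only [StepRel, Fin.val_castSucc, Fin.val_succ]
    rw [this]
    grind
  simp only [hp]
  constructor
  · rintro ⟨hc, -, hlast, hpos⟩
    refine ⟨fun i => ?_, fun i => ⟨fun h => ?_, fun h => ?_⟩, fun j hj => ?_, hlast⟩
    · have := hc i
      tauto
    · rcases hc i with h' | h' | h'
      · exact h'.2
      · omega
      · omega
    · rcases hc i with h' | h' | h'
      · omega
      · omega
      · exact h'.2
    · exact hpos ⟨j, by omega⟩
  · rintro ⟨hs, hc, hpos, hlast⟩
    refine ⟨fun i => ?_, psum_zero _ _, hlast, fun i => hpos i (by omega)⟩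
    rcases hs i with h | h | h
    · exact Or.inl ⟨h, (hc i).1 h⟩
    · exact Or.inr (Or.inl h)
    · exact Or.inr (Or.inr ⟨h, (hc i).2 h⟩)

theorem exists_vertices_eq {n k : ℕ} {l : List (ℤ × Fin (n + 2))}
    (hl : l ∈ firstPassages 0 univ k) : ∃ p σ, vertices (n + 2) p σ = l := by
  rw [mem_firstPassages] at hl
  obtain ⟨hl, hS, -⟩ := hl
  have hlen : l.length = n + 2 := by
    have := congrArg Multiset.card hS
    simpa [labels] using this
  have key : ∀ m, l.length = m → ∃ g : Fin m → ℤ × Fin (n + 2), List.ofFn g = l := by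
    rintro _ rfl
    exact ⟨l.get, List.ofFn_get l⟩
  obtain ⟨g, rfl⟩ := key _ hlen
  rw [isFirstPassage_ofFn] at hl
  have hsurj : Function.Surjective fun i => (g i).2 := by
    intro a
    have ha : a ∈ labels (List.ofFn g) := by rw [hS]; exact mem_univ a
    rw [labels_ofFn, Multiset.mem_map] at ha
    obtain ⟨i, -, hi⟩ := ha
    exact ⟨i, hi⟩
  let p : Fin (n + 1) → ℤ := fun i => (g i.succ).1 - (g i.castSucc).1
  have hp : ∀ i : Fin (n + 2), psum (n + 2) p i = (g i).1 := by
    intro i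
    induction i using Fin.induction with
    | zero => rw [hl.2.1]; exact psum_zero _ _
    | succ i ih =>
      have := psum_succ (n + 2) p i
      rw [Fin.val_succ, this]
      rw [Fin.val_castSucc] at ih
      rw [ih]
      simp [p]
  refine ⟨p, Equiv.ofBijective _ (Finite.surjective_iff_bijective.1 hsurj), ?_⟩
  rw [vertices]
  congr 1
  ext1 i
  exact Prod.ext (hp i) rfl

theorem vertices_injective {n : ℕ} {p p' : Fin (n + 2 - 1) → ℤ}
    {σ σ' : Equiv.Perm (Fin (n + 2))} (h : vertices (n + 2) p σ = vertices (n + 2) p' σ') :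
    p = p' ∧ σ = σ' := by
  have h' := fun i => congrFun (List.ofFn_injective h) i
  simp only [Prod.mk.injEq] at h'
  refine ⟨funext fun i => ?_, Equiv.ext fun i => (h' i).2⟩
  have h1 : psum (n + 2) p i = psum (n + 2) p' i := (h' (Fin.castSucc (n := n + 1) i)).1
  have h2 : psum (n + 2) p (i + 1) = psum (n + 2) p' (i + 1) := (h' (Fin.succ (n := n + 1) i)).1
  rw [psum_succ, psum_succ, h1] at h2
  exact add_left_cancel h2

theorem card_motzkin_eq_firstPassageCount (n k : ℕ) :
    Nat.card {ps : (Fin (n + 2 - 1) → ℤ) × Equiv.Perm (Fin (n + 2)) //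
      IsMotzkinPath (n + 2) ps.1 ps.2 ∧ horizCount (n + 2) ps.1 = k} =
      firstPassageCount (n + 2) k := by
  rw [firstPassageCount, ← Nat.card_eq_finsetCard]
  refine Nat.card_eq_of_bijective
    (fun ps => ⟨vertices (n + 2) ps.1.1 ps.1.2, vertices_mem_firstPassages.2 ps.2⟩) ⟨?_, ?_⟩
  · rintro ⟨⟨p, σ⟩, _⟩ ⟨⟨p', σ'⟩, _⟩ h
    obtain ⟨rfl, rfl⟩ := vertices_injective (congrArg Subtype.val h)
    rfl
  · rintro ⟨l, hl⟩
    obtain ⟨p, σ, rfl⟩ := exists_vertices_eq hl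
    exact ⟨⟨(p, σ), vertices_mem_firstPassages.1 hl⟩, rfl⟩

/-- For `n ≥ 2`, the number of well-labelled Motzkin paths of size `n` with exactly `k`
horizontal steps is `C(n,k)·C(n-2,k)·k!·(n-k-1)!!·(n-k-3)!!` if `n-k` is even and `0`
otherwise. -/
theorem motzkin_count_horiz (n k : ℕ) (hn : 2 ≤ n) :
    Nat.card {ps : (Fin (n - 1) → ℤ) × Equiv.Perm (Fin n) //
        IsMotzkinPath n ps.1 ps.2 ∧ horizCount n ps.1 = k} =
      if Even (n - k) then
        n.choose k * (n - 2).choose k * k.factorial *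
          Nat.doubleFactorial (n - k - 1) * Nat.doubleFactorial (n - k - 3)
      else 0 := by
  obtain ⟨n, rfl⟩ : ∃ m, n = m + 2 := ⟨n - 2, by omega⟩
  rw [card_motzkin_eq_firstPassageCount]
  have h := firstPassageCount_eq (n + 2) k
  by_cases hk : n < k
  · rw [passageCoeff_eq_zero (by omega), mul_zero, Nat.cast_eq_zero] at h
    rw [h, Nat.add_sub_cancel, Nat.choose_eq_zero_of_lt hk]
    simp
  rw [← Nat.cast_inj (R := ℚ), h, passageCoeff,
    ← Nat.choose_mul_factorial_mul_factorial (show k ≤ n + 2 by omega)]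
  have hc := factorial_mul_sqrtCoeff (show 2 ≤ n + 2 - k by omega)
  simp only [Nat.add_sub_cancel]
  push_cast
  split_ifs at hc ⊢
  · linear_combination ((n + 2).choose k * k.factorial * n.choose k : ℚ) * hc
  · linear_combination ((n + 2).choose k * k.factorial * n.choose k : ℚ) * hc
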